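/- arXiv:1102.3978 — 2 statements merged into one kernel-verified Lean document; each statement's English description precedes it below -/
import Mathlib

section
/- Let m ≥ 1, n ≥ 1, let ζ ∈ ℂ be a primitive n-th root of unity, and let s ∈ {1,…,n}. Then P_n(ζ^s) = (−1)^{(m−1)(n−1)s} · binom(m·gcd(s,n) − 1, gcd(s,n) − 1). -/
/-- `U_n`: sequences of `n` nonnegative integers summing to `(m−1)n`. -/
def USet (m n : ℕ) : Set (List ℕ) := {a | a.length = n ∧ a.sum = (m - 1) * n}

/-- The weight `wt(a) = ∑_{i=1}^n (n−i)(m−1−a_i)` of a sequence of length `n`. -/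
def wtZ (m : ℕ) (a : List ℕ) : ℤ :=
  ∑ i ∈ Finset.range a.length, ((a.length : ℤ) - 1 - i) * ((m : ℤ) - 1 - a.getD i 0)

open PowerSeries in
lemma geom_mul_aux (c : ℂ) : (mk (fun k => c ^ k) : ℂ⟦X⟧) * (1 - C c * X) = 1 := by
  ext (_ | k)
  · simp
  · rw [mul_sub, mul_one, mul_comm (C c) X, ← mul_assoc, map_sub, coeff_mul_C,
      coeff_succ_mul_X]
    simp [coeff_one, pow_succ]

open PowerSeries in
lemma prod_range_aux (η : ℂ) (d : ℕ) (hd : 0 < d) (h : IsPrimitiveRoot η d) :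
    ∏ j ∈ Finset.range d, (1 - C (η ^ j) * X : ℂ⟦X⟧) = 1 - X ^ d := by
  have h' : IsPrimitiveRoot (C η : ℂ⟦X⟧) d :=
    h.map_of_injective (f := (C : ℂ →+* ℂ⟦X⟧)) C_injective
  have := h'.pow_sub_pow_eq_prod_sub_mul 1 X hd
  rw [one_pow] at this
  rw [this]
  refine Finset.prod_nbij (fun j => (C η : ℂ⟦X⟧) ^ j) ?_ ?_ ?_ ?_
  · intro j _
    rw [Polynomial.mem_nthRootsFinset hd, ← pow_mul, mul_comm, pow_mul, h'.pow_eq_one, one_pow]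
  · intro i hi j hj hij
    simp only [Finset.coe_range, Set.mem_Iio] at hi hj
    exact h'.pow_inj hi hj hij
  · intro x hx
    rw [Finset.mem_coe, Polynomial.mem_nthRootsFinset hd] at hx
    have : NeZero d := ⟨hd.ne'⟩
    obtain ⟨i, hi, rfl⟩ := h'.eq_pow_of_pow_eq_one hx
    exact ⟨i, by simpa using hi, rfl⟩
  · intro j _
    simp

open PowerSeries in
lemma prod_range_mul_aux (η : ℂ) (d g : ℕ) (hd : 0 < d) (h : IsPrimitiveRoot η d) :
    ∏ j ∈ Finset.range (d * g), (1 - C (η ^ j) * X : ℂ⟦X⟧) = (1 - X ^ d) ^ g := by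
  induction g with
  | zero => simp
  | succ g ih =>
    rw [Nat.mul_succ, Finset.prod_range_add, ih, pow_succ]
    congr 1
    rw [← prod_range_aux η d hd h]
    refine Finset.prod_congr rfl fun j _ => ?_
    rw [pow_add, pow_mul, h.pow_eq_one, one_pow, one_mul]

open PowerSeries in
lemma coeff_aux (η : ℂ) (d g k : ℕ) (hd : 0 < d) (hg : 0 < g) (h : IsPrimitiveRoot η d) :
    coeff (d * k) (∏ j ∈ Finset.range (d * g), (mk (fun k => (η ^ j) ^ k) : ℂ⟦X⟧))
      = ((g - 1 + k).choose (g - 1) : ℂ) := by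
  obtain ⟨g, rfl⟩ : ∃ g', g = g' + 1 := ⟨g - 1, by omega⟩
  have h1 : (∏ j ∈ Finset.range (d * (g + 1)), (mk (fun k => (η ^ j) ^ k) : ℂ⟦X⟧))
      * (1 - X ^ d) ^ (g + 1) = 1 := by
    rw [← prod_range_mul_aux η d (g + 1) hd h, ← Finset.prod_mul_distrib]
    exact Finset.prod_eq_one fun j _ => geom_mul_aux _
  have h2 := congrArg (expand d hd.ne') (mk_add_choose_mul_one_sub_pow_eq_one ℂ g)
  simp only [map_mul, map_pow, map_sub, map_one, expand_X] at h2
  rw [mul_comm] at h2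
  rw [left_inv_eq_right_inv h1 h2]
  simp [coeff_expand_mul]

lemma sign_aux (n : ℕ) (hn : 1 ≤ n) (ζ : ℂ) (hζ : IsPrimitiveRoot ζ n) :
    ζ ^ (∑ i ∈ Finset.range n, i) = (-1) ^ (n - 1) := by
  rcases Nat.even_or_odd' n with ⟨c, rfl | rfl⟩
  · have : ∑ i ∈ Finset.range (2 * c), i = c * (2 * c - 1) := by
      rw [Finset.sum_range_id, mul_assoc, Nat.mul_div_cancel_left _ two_pos]
    rw [this, pow_mul]
    congr 1
    have h2 : IsPrimitiveRoot (ζ ^ c) 2 := hζ.pow (by omega) (mul_comm _ _)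
    exact h2.eq_neg_one_of_two_right
  · have : ∑ i ∈ Finset.range (2 * c + 1), i = (2 * c + 1) * c := by
      rw [Finset.sum_range_id, Nat.add_sub_cancel, mul_left_comm,
        Nat.mul_div_cancel_left _ two_pos]
    rw [this, pow_mul, hζ.pow_eq_one, one_pow]
    simp

lemma list_sum_aux (a : List ℕ) : ∑ i ∈ Finset.range a.length, a.getD i 0 = a.sum := by
  induction a with
  | nil => simp
  | cons x a ih =>
    rw [List.length_cons, Finset.sum_range_succ']
    simp only [List.getD_cons_succ, List.getD_cons_zero, ih, List.sum_cons, add_comm]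

lemma bij_aux (m n : ℕ) : Set.BijOn (fun a : List ℕ => a.toFinsupp) (USet m n)
    (↑(Finset.finsuppAntidiag (Finset.range n) ((m - 1) * n)) : Set (ℕ →₀ ℕ)) := by
  refine ⟨?_, ?_, ?_⟩
  · rintro a ⟨h1, h2⟩
    rw [Finset.mem_coe, Finset.mem_finsuppAntidiag]
    refine ⟨?_, ?_⟩
    · subst h1
      rw [← h2, ← list_sum_aux]
      rfl
    · rw [List.toFinsupp_support, h1]
      exact Finset.filter_subset _ _
  · rintro a ⟨h1, _⟩ b ⟨h2, _⟩ hab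
    apply List.ext_getElem (h1.trans h2.symm)
    intro i hi hi'
    have := DFunLike.congr_fun hab i
    simpa [hi, hi'] using this
  · intro f hf
    rw [Finset.mem_coe, Finset.mem_finsuppAntidiag] at hf
    have key : ∀ i, ((List.range n).map f).getD i 0 = f i := by
      intro i
      by_cases hi : i < n
      · simp [hi]
      · have : f i = 0 := by
          by_contra h
          exact hi (Finset.mem_range.1 (hf.2 (Finsupp.mem_support_iff.2 h)))
        simp [hi, this]
    refine ⟨(List.range n).map f, ⟨by simp, ?_⟩, ?_⟩
    · rw [← list_sum_aux, ← hf.1]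
      simp only [key]
      simp
    · ext i
      exact key i

/-- Evaluating `P_n(q) = ∑_{a ∈ U_n} q^{wt(a)}` at `q = ζ^s` for `ζ` a primitive `n`-th
root of unity gives `(−1)^{(m−1)(n−1)s} · binom(m·gcd(s,n) − 1, gcd(s,n) − 1)`. -/
theorem stmt13 (m n : ℕ) (hm : 1 ≤ m) (hn : 1 ≤ n) (ζ : ℂ) (hζ : IsPrimitiveRoot ζ n)
    (s : ℕ) (hs1 : 1 ≤ s) (hsn : s ≤ n) :
    (∑ᶠ a ∈ USet m n, (ζ ^ s) ^ wtZ m a)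
      = (-1 : ℂ) ^ ((m - 1) * (n - 1) * s)
          * ((m * Nat.gcd s n - 1).choose (Nat.gcd s n - 1) : ℂ) := by
  obtain ⟨k, rfl⟩ : ∃ k, m = k + 1 := ⟨m - 1, by omega⟩
  have hg : 0 < Nat.gcd s n := Nat.gcd_pos_of_pos_left _ hs1
  obtain ⟨d, hd⟩ := Nat.gcd_dvd_right s n
  have hbij := bij_aux (k + 1) n
  set g := Nat.gcd s n with hgdef
  have hd0 : 0 < d := by
    rcases Nat.eq_zero_or_pos d with h | h
    · subst h; omega
    · exact h
  have hω : IsPrimitiveRoot (ζ ^ s) d := by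
    rw [IsPrimitiveRoot.iff_orderOf, orderOf_pow' _ (by omega), ← hζ.eq_orderOf, Nat.gcd_comm,
      ← hgdef]
    exact Nat.div_eq_of_eq_mul_right hg hd
  have hsign : (ζ ^ s) ^ ((∑ i ∈ Finset.range n, i) * k) = (-1) ^ (k * (n - 1) * s) := by
    rw [← pow_mul, show s * ((∑ i ∈ Finset.range n, i) * k)
      = (∑ i ∈ Finset.range n, i) * (k * s) by ring, pow_mul, sign_aux n hn ζ hζ, ← pow_mul]
    congr 1; ring
  set ω := ζ ^ s with hωdef
  have hω0 : ω ≠ 0 := hω.ne_zero hd0.ne'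
  have hco := coeff_aux ω⁻¹ d g (g * k) hd0 hg hω.inv
  rw [← Finset.prod_range_reflect, PowerSeries.coeff_prod, mul_comm d g, ← hd] at hco
  have e1 : d * (g * k) = (k + 1 - 1) * n := by rw [hd, Nat.add_sub_cancel]; ring
  have e2 : g - 1 + g * k = (k + 1) * g - 1 := by
    have : (k + 1) * g = g * k + g := by ring
    omega
  rw [e1, e2] at hco
  rw [← hco, Nat.add_sub_cancel, ← hsign, Finset.mul_sum]
  rw [← finsum_mem_coe_finset]
  rw [Nat.add_sub_cancel] at hbij
  refine finsum_mem_eq_of_bijOn _ hbij ?_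
  rintro a ⟨h1, h2⟩
  simp only [PowerSeries.coeff_mk, List.toFinsupp_apply]
  have hw : wtZ (k + 1) a = (((∑ i ∈ Finset.range n, i) * k : ℕ) : ℤ)
      - ((∑ i ∈ Finset.range n, (n - 1 - i) * a.getD i 0 : ℕ) : ℤ) := by
    rw [← Finset.sum_range_reflect, Finset.sum_mul]
    push_cast
    rw [← Finset.sum_sub_distrib, wtZ, h1]
    refine Finset.sum_congr rfl fun i hi => ?_
    rw [Finset.mem_range] at hi
    have : ((n - 1 - i : ℕ) : ℤ) = n - 1 - i := by omega
    rw [this]; push_cast; ring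
  rw [hw, zpow_sub₀ hω0, zpow_natCast, zpow_natCast, div_eq_mul_inv, ← inv_pow,
    ← Finset.prod_pow_eq_pow_sum]
  simp only [pow_mul]
end

section
/- Let m ≥ 1 and n ≥ 1. For all integers i and j, the number of C_n-orbits C on U_n^{prim,+} with wt(C) ≡ i (mod n) equals the number of C_n-orbits C on U_n^{prim,+} with wt(C) ≡ j (mod n); equivalently, for every i this number equals |U_n^{prim,+}/C_n| / n. -/
/-- A sequence is primitive if it differs from all of its proper cyclic shifts. -/
def Primitive (a : List ℕ) : Prop := ∀ i, 0 < i → i < a.length → a.rotate i ≠ a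

/-- `U_n^{prim}`: the primitive sequences in `U_n`. -/
def UPrim (m n : ℕ) : Set (List ℕ) := {a ∈ USet m n | Primitive a}

/-- `U_n^{prim,+}`: equal to `U_n^{prim}`, together with the twofold repetitions `bb` of
primitive sequences `b ∈ U_{n/2}^{prim}` when `m` is even and `n ≡ 2 mod 4`. -/
def UPrimPlus (m n : ℕ) : Set (List ℕ) :=
  UPrim m n ∪ {a | Even m ∧ n % 4 = 2 ∧ ∃ b ∈ UPrim m (n / 2), a = b ++ b}

/-- The `C_n`-orbit (cyclic class) of a sequence. -/
def rotClass (a : List ℕ) : Set (List ℕ) := {b | ∃ i, b = a.rotate i}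

/-- The set of `C_n`-orbits on a shift-invariant set `S`. -/
def orbitsOn (S : Set (List ℕ)) : Set (Set (List ℕ)) := {O | ∃ a ∈ S, O = rotClass a}

/-- The weight of a cyclic class: the maximal weight of its elements. -/
noncomputable def wtOrb (m : ℕ) (O : Set (List ℕ)) : ℤ := sSup (wtZ m '' O)

noncomputable def UF (m n : ℕ) : Finset (ℕ → ℕ) :=
  open Classical in
  ((Finset.range n).finsuppAntidiag ((m - 1) * n)).image (fun g i => g (i % n))

/-- The shift. -/
def sh (f : ℕ → ℕ) : ℕ → ℕ := fun i => f (i + 1)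

theorem sh_iter (k : ℕ) (f : ℕ → ℕ) (i : ℕ) : sh^[k] f i = f (i + k) := by
  induction k generalizing i with
  | zero => rfl
  | succ k ih =>
    rw [Function.iterate_succ_apply']
    show sh^[k] f (i + 1) = _
    rw [ih]; congr 1; ring

theorem isPer_iff (n : ℕ) (f : ℕ → ℕ) :
    Function.IsPeriodicPt sh n f ↔ ∀ i, f (i + n) = f i := by
  unfold Function.IsPeriodicPt Function.IsFixedPt
  rw [funext_iff]
  simp [sh_iter]

theorem mem_UF {m n : ℕ} (hn : 1 ≤ n) (f : ℕ → ℕ) :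
    f ∈ UF m n ↔ Function.IsPeriodicPt sh n f ∧ ∑ i ∈ Finset.range n, f i = (m - 1) * n := by
  classical
  unfold UF
  rw [isPer_iff]
  simp only [Finset.mem_image, Finset.mem_finsuppAntidiag]
  constructor
  · rintro ⟨g, ⟨h1, h2⟩, rfl⟩
    refine ⟨fun i => by simp, ?_⟩
    rw [← h1]
    exact Finset.sum_congr rfl (fun i hi => by simp only [Nat.mod_eq_of_lt (Finset.mem_range.mp hi)])
  · rintro ⟨h1, h2⟩
    refine ⟨Finsupp.onFinset (Finset.range n) (fun i => if i < n then f i else 0) ?_, ⟨?_, ?_⟩, ?_⟩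
    · intro i hi; simp at hi ⊢; exact hi.1
    · rw [← h2]
      exact Finset.sum_congr rfl (fun i hi => by simp [Finset.mem_range.mp hi])
    · exact Finsupp.support_onFinset_subset
    · funext i
      simp only [Finsupp.onFinset_apply, Nat.mod_lt i hn, if_true]
      exact (Function.Periodic.map_mod_nat (f := f) h1 i)

theorem sum_UF {m n : ℕ} (_hn : 1 ≤ n) (φ : (ℕ → ℕ) → ℂ)
    (hφ : ∀ f g : ℕ → ℕ, (∀ i < n, f i = g i) → φ f = φ g) :
    ∑ f ∈ UF m n, φ f = ∑ l ∈ (Finset.range n).finsuppAntidiag ((m - 1) * n), φ l := by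
  classical
  unfold UF
  rw [Finset.sum_image]
  · refine Finset.sum_congr rfl fun l _ => hφ _ _ fun i hi => ?_
    rw [Nat.mod_eq_of_lt hi]
  · intro a ha b hb hab
    simp only [Finset.mem_coe, Finset.mem_finsuppAntidiag] at ha hb
    ext i
    by_cases hi : i < n
    · have := congrFun hab i
      simpa [Nat.mod_eq_of_lt hi] using this
    · have h1 : i ∉ a.support := fun h => hi (Finset.mem_range.mp (ha.2 h))
      have h2 : i ∉ b.support := fun h => hi (Finset.mem_range.mp (hb.2 h))
      rw [Finsupp.notMem_support_iff.mp h1, Finsupp.notMem_support_iff.mp h2]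

/-- The weight. -/
def wF (m n : ℕ) (f : ℕ → ℕ) : ℤ :=
  ∑ i ∈ Finset.range n, ((n : ℤ) - 1 - i) * ((m : ℤ) - 1 - f i)

theorem prod_roots {d : ℕ} (hd : 0 < d) {ζ : ℂ} (hζ : IsPrimitiveRoot ζ d) :
    ∏ i ∈ Finset.range d, (1 - PowerSeries.C (ζ ^ i) * (PowerSeries.X : PowerSeries ℂ))
      = 1 - PowerSeries.X ^ d := by
  have h := hζ.map_of_injective (f := (PowerSeries.C : ℂ →+* PowerSeries ℂ))
    PowerSeries.C_injective
  have := congrArg (Polynomial.eval 1)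
    (X_pow_sub_C_eq_prod h hd (rfl : (PowerSeries.X : PowerSeries ℂ) ^ d = _))
  simp only [Polynomial.eval_sub, Polynomial.eval_pow, Polynomial.eval_X, Polynomial.eval_C,
    one_pow, Polynomial.eval_prod] at this
  rw [this]
  simp

theorem prod_roots_mul {d : ℕ} (hd : 0 < d) {ζ : ℂ} (hζ : IsPrimitiveRoot ζ d) (e : ℕ) :
    ∏ i ∈ Finset.range (d * e), (1 - PowerSeries.C (ζ ^ i) * (PowerSeries.X : PowerSeries ℂ))
      = (1 - PowerSeries.X ^ d) ^ e := by
  induction e with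
  | zero => simp
  | succ e ih =>
    rw [mul_add, mul_one, Finset.prod_range_add, ih, pow_succ, ← prod_roots hd hζ]
    congr 1
    refine Finset.prod_congr rfl fun i _ => ?_
    rw [pow_add, pow_mul, hζ.pow_eq_one, one_pow, one_mul]

theorem geo_mul (c : ℂ) : PowerSeries.mk (fun k => c ^ k) * (1 - PowerSeries.C c * PowerSeries.X) = 1 := by
  ext k
  rw [mul_sub, mul_one, mul_comm (PowerSeries.C c), ← mul_assoc]
  cases k with
  | zero => simp
  | succ k => simp [PowerSeries.coeff_succ_mul_X, PowerSeries.coeff_one, pow_succ]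

theorem prod_geo {d : ℕ} (hd : 0 < d) {ζ : ℂ} (hζ : IsPrimitiveRoot ζ d) (e : ℕ) :
    ∏ i ∈ Finset.range (d * e), PowerSeries.mk (fun k => (ζ ^ i) ^ k)
      = PowerSeries.expand d hd.ne' (∏ _i ∈ Finset.range e, PowerSeries.mk (fun k => (1:ℂ) ^ k)) := by
  have h1 : (∏ i ∈ Finset.range (d * e), PowerSeries.mk (fun k => (ζ ^ i) ^ k)) *
      (1 - PowerSeries.X ^ d) ^ e = 1 := by
    rw [← prod_roots_mul hd hζ, ← Finset.prod_mul_distrib]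
    exact Finset.prod_eq_one fun i _ => geo_mul _
  have h2 : PowerSeries.expand d hd.ne' (∏ i ∈ Finset.range e, PowerSeries.mk (fun k => (1:ℂ) ^ k))
      * (1 - PowerSeries.X ^ d) ^ e = 1 := by
    have : (1 - PowerSeries.X ^ d : PowerSeries ℂ) ^ e =
        PowerSeries.expand d hd.ne' (∏ i ∈ Finset.range e, (1 - PowerSeries.C 1 * PowerSeries.X)) := by
      simp
    rw [this, ← map_mul, ← Finset.prod_mul_distrib, Finset.prod_eq_one fun i _ => geo_mul _, map_one]
  exact mul_right_cancel₀ (right_ne_zero_of_mul_eq_one h1) (h1.trans h2.symm)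

theorem antidiag_sum {d : ℕ} (hd : 0 < d) {ζ : ℂ} (hζ : IsPrimitiveRoot ζ d) (e M : ℕ) :
    ∑ l ∈ (Finset.range (d * e)).finsuppAntidiag (d * M), ∏ i ∈ Finset.range (d * e), (ζ ^ i) ^ (l i)
      = ((Finset.range e).finsuppAntidiag M).card := by
  have := congrArg (PowerSeries.coeff (d * M)) (prod_geo hd hζ e)
  rw [PowerSeries.coeff_expand_mul, PowerSeries.coeff_prod, PowerSeries.coeff_prod] at this
  simpa using this

theorem antidiag_sum' {d : ℕ} (hd : 0 < d) {ζ : ℂ} (hζ : IsPrimitiveRoot ζ d) (e M : ℕ) :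
    ∑ l ∈ (Finset.range (d * e)).finsuppAntidiag (d * M),
      ∏ i ∈ Finset.range (d * e), (ζ ^ (d * e - 1 - i)) ^ (l i)
      = ((Finset.range e).finsuppAntidiag M).card := by
  have := congrArg (PowerSeries.coeff (d * M)) (prod_geo hd hζ e)
  rw [← Finset.prod_range_reflect, PowerSeries.coeff_expand_mul, PowerSeries.coeff_prod,
    PowerSeries.coeff_prod] at this
  simpa using this

theorem UF_card {m n : ℕ} (hn : 1 ≤ n) :
    ((UF m n).card : ℂ) = (((Finset.range n).finsuppAntidiag ((m - 1) * n)).card : ℂ) := by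
  have := sum_UF (m := m) hn (fun _ => (1 : ℂ)) (fun _ _ _ => rfl)
  simpa using this

theorem zpow_sum' {ζ : ℂ} (h0 : ζ ≠ 0) (s : Finset ℕ) (f : ℕ → ℤ) :
    ζ ^ (∑ i ∈ s, f i) = ∏ i ∈ s, ζ ^ f i := by
  classical
  induction s using Finset.induction_on with
  | empty => simp
  | insert a s ha ih => rw [Finset.sum_insert ha, Finset.prod_insert ha, zpow_add₀ h0, ih]

/-- Generating function of `U_n`. -/
noncomputable def FF (m n : ℕ) (ζ : ℂ) : ℂ := ∑ f ∈ UF m n, ζ ^ (wF m n f)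

theorem FF_one (m n : ℕ) : FF m n 1 = (UF m n).card := by simp [FF]

theorem FF_eval {m : ℕ} (hm : 1 ≤ m) {d e : ℕ} (hd : 0 < d) (he : 0 < e) {ζ : ℂ}
    (hζ : IsPrimitiveRoot ζ d) :
    FF m (d * e) ζ = ζ ^ ((m - 1) * (d * e * (d * e - 1) / 2)) * (UF m e).card := by
  have hn : 1 ≤ d * e := Nat.mul_pos hd he
  have h0 : ζ ≠ 0 := hζ.ne_zero hd.ne'
  unfold FF
  rw [sum_UF hn, UF_card he]
  · have h := antidiag_sum' hd hζ.inv e ((m - 1) * e)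
    rw [← h, Finset.mul_sum]
    have : d * ((m - 1) * e) = (m - 1) * (d * e) := by ring
    rw [this]
    refine Finset.sum_congr rfl fun l _ => ?_
    rw [← Finset.sum_range_id_mul_two, Nat.mul_div_cancel _ (by norm_num),
      ← Finset.sum_range_reflect, Finset.mul_sum, ← Finset.prod_pow_eq_pow_sum,
      ← Finset.prod_mul_distrib]
    unfold wF
    rw [zpow_sum' h0]
    refine Finset.prod_congr rfl fun i hi => ?_
    have hi' : i < d * e := Finset.mem_range.mp hi
    rw [inv_pow, inv_pow, ← pow_mul, ← zpow_natCast, ← zpow_natCast, ← zpow_neg, ← zpow_add₀ h0]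
    congr 1
    have : ((d * e - 1 - i : ℕ) : ℤ) = (d * e : ℕ) - 1 - i := by omega
    rw [Nat.cast_mul (m - 1), Nat.cast_mul (d * e - 1 - i), this, Nat.cast_sub hm]
    push_cast
    ring
  · intro f g hfg
    unfold wF
    rw [Finset.sum_congr rfl fun i hi => by rw [hfg i (Finset.mem_range.mp hi)]]

theorem sum_range_mul_per {k : ℕ} {M : Type*} [AddCommMonoid M] {f : ℕ → M}
    (hf : ∀ i, f (i + k) = f i) (e : ℕ) :
    ∑ i ∈ Finset.range (k * e), f i = e • ∑ i ∈ Finset.range k, f i := by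
  induction e with
  | zero => simp
  | succ e ih =>
    rw [mul_add, mul_one, Finset.sum_range_add, ih, succ_nsmul]
    congr 1
    refine Finset.sum_congr rfl fun i _ => ?_
    have h : Function.Periodic f k := hf
    have := h.nat_mul e i
    simp only [Nat.cast_id] at this
    rw [← this]; congr 1; ring

theorem UF_mul {m k e : ℕ} (hk : 1 ≤ k) (he : 1 ≤ e) (f : ℕ → ℕ)
    (hf : Function.IsPeriodicPt sh k f) : f ∈ UF m (k * e) ↔ f ∈ UF m k := by
  rw [mem_UF hk, mem_UF (Nat.mul_pos hk he)]
  have hf' := (isPer_iff _ _).mp hf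
  rw [sum_range_mul_per hf']
  have : (m - 1) * (k * e) = e * ((m - 1) * k) := by ring
  rw [this, smul_eq_mul]
  constructor
  · rintro ⟨_, h⟩
    exact ⟨hf, Nat.eq_of_mul_eq_mul_left he h⟩
  · rintro ⟨_, h⟩
    exact ⟨hf.mul_const e, by rw [h]⟩

theorem UF_sum_zero {m n : ℕ} (hm : 1 ≤ m) (hn : 1 ≤ n) {f : ℕ → ℕ} (hf : f ∈ UF m n) :
    ∑ i ∈ Finset.range n, ((m : ℤ) - 1 - f i) = 0 := by
  have := ((mem_UF hn f).mp hf).2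
  rw [Finset.sum_sub_distrib, ← Nat.cast_sum, this]
  simp [Nat.cast_sub hm]; ring

theorem wF_mul {m k : ℕ} (hm : 1 ≤ m) (hk : 1 ≤ k) (e : ℕ) {f : ℕ → ℕ} (hf : f ∈ UF m k) :
    wF m (k * e) f = e * wF m k f := by
  have hp := (isPer_iff _ _).mp ((mem_UF hk f).mp hf).1
  have hz := UF_sum_zero hm hk hf
  induction e with
  | zero => simp [wF]
  | succ e ih =>
    have h1 : wF m (k * (e + 1)) f = (k * e) * ∑ i ∈ Finset.range k, ((m : ℤ) - 1 - f i)
        + wF m k f + wF m (k * e) f := by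
      unfold wF
      rw [show k * (e + 1) = k + k * e by ring, Finset.sum_range_add, Finset.mul_sum,
        ← Finset.sum_add_distrib]
      congr 1
      · refine Finset.sum_congr rfl fun i _ => ?_
        push_cast; ring
      · refine Finset.sum_congr rfl fun i _ => ?_
        rw [add_comm k i, hp]
        push_cast; ring
    rw [h1, hz, ih]; push_cast; ring

theorem wF_sh {m n : ℕ} (hm : 1 ≤ m) (hn : 1 ≤ n) {f : ℕ → ℕ} (hf : f ∈ UF m n) :
    wF m n (sh f) = wF m n f - n * ((m : ℤ) - 1 - f 0) := by
  have hp := (isPer_iff _ _).mp ((mem_UF hn f).mp hf).1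
  have hz := UF_sum_zero hm hn hf
  obtain ⟨n, rfl⟩ : ∃ k, n = k + 1 := ⟨n - 1, by omega⟩
  have h0 : f (n + 1) = f 0 := by simpa using hp 0
  rw [Finset.sum_range_succ'] at hz
  unfold wF sh
  rw [Finset.sum_range_succ, Finset.sum_range_succ', h0]
  have : ∑ x ∈ Finset.range n, (((n + 1 : ℕ) : ℤ) - 1 - x) * ((m : ℤ) - 1 - f (x + 1))
    = ∑ x ∈ Finset.range n, (((n + 1 : ℕ) : ℤ) - 1 - ((x + 1 : ℕ) : ℤ)) * ((m : ℤ) - 1 - f (x + 1))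
      + ∑ x ∈ Finset.range n, ((m : ℤ) - 1 - f (x + 1)) := by
    rw [← Finset.sum_add_distrib]
    refine Finset.sum_congr rfl fun i _ => ?_
    push_cast; ring
  rw [this]
  push_cast
  linear_combination hz

theorem sh_UF {m n : ℕ} (hn : 1 ≤ n) {f : ℕ → ℕ} (hf : f ∈ UF m n) : sh f ∈ UF m n := by
  rw [mem_UF hn] at hf ⊢
  obtain ⟨h1, h2⟩ := hf
  refine ⟨h1.map (Function.Commute.refl sh), ?_⟩
  rw [isPer_iff] at h1
  rw [← h2]
  have a := Finset.sum_range_succ f n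
  rw [Finset.sum_range_succ'] at a
  have := h1 0
  simp only [zero_add] at this
  simp only [sh]
  omega

/-- Minimal period. -/
noncomputable def per (f : ℕ → ℕ) : ℕ := Function.minimalPeriod sh f

/-- Primitive periodic sequences. -/
noncomputable def PF (m n : ℕ) : Finset (ℕ → ℕ) := (UF m n).filter (fun f => per f = n)

theorem UF_fiber {m n k : ℕ} (hn : 1 ≤ n) (hk : k ∣ n) :
    (UF m n).filter (fun f => per f = k) = PF m k := by
  obtain ⟨e, rfl⟩ := hk
  have hk : 1 ≤ k := Nat.pos_of_mul_pos_right hn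
  have he : 1 ≤ e := Nat.pos_of_mul_pos_left hn
  ext f
  simp only [PF, Finset.mem_filter]
  refine and_congr_left fun h => UF_mul hk he f ?_
  rw [Function.isPeriodicPt_iff_minimalPeriod_dvd]
  exact dvd_of_eq h

/-- Generating function of primitive sequences. -/
noncomputable def PG (m n : ℕ) (ζ : ℂ) : ℂ := ∑ f ∈ PF m n, ζ ^ (wF m n f)

theorem PG_pow {m k e : ℕ} (hm : 1 ≤ m) (hk : 1 ≤ k) (ζ : ℂ) :
    ∑ f ∈ PF m k, ζ ^ (wF m (k * e) f) = PG m k (ζ ^ e) := by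
  refine Finset.sum_congr rfl fun f hf => ?_
  rw [wF_mul hm hk e (Finset.mem_filter.mp hf).1, zpow_mul, zpow_natCast]

theorem FF_eq_sum {m n : ℕ} (hm : 1 ≤ m) (hn : 1 ≤ n) (ζ : ℂ) :
    FF m n ζ = ∑ k ∈ n.divisors, PG m k (ζ ^ (n / k)) := by
  unfold FF
  rw [← Finset.sum_fiberwise_of_maps_to (g := per) (t := n.divisors)]
  · refine Finset.sum_congr rfl fun k hk => ?_
    have hk' := Nat.dvd_of_mem_divisors hk
    rw [UF_fiber hn hk']
    obtain ⟨e, rfl⟩ := hk'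
    have hk : 1 ≤ k := Nat.pos_of_mul_pos_right hn
    rw [PG_pow hm hk, Nat.mul_div_cancel_left _ hk]
  · intro f hf
    rw [Nat.mem_divisors]
    refine ⟨?_, by omega⟩
    exact ((mem_UF hn f).mp hf).1.minimalPeriod_dvd

/-- Correction term. -/
noncomputable def BG (m n : ℕ) (ζ : ℂ) : ℂ :=
  if Even m ∧ n % 4 = 2 then 2 * PG m (n / 2) (ζ ^ 2) else 0

noncomputable def QG (m n : ℕ) (ζ : ℂ) : ℂ := PG m n ζ + BG m n ζ

noncomputable def HG (m n : ℕ) (ζ : ℂ) : ℂ := ∑ k ∈ n.divisors, QG m k (ζ ^ (n / k))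

theorem HG_of_odd {m n : ℕ} (hm : 1 ≤ m) (hn : 1 ≤ n) (h : Odd m ∨ Odd n) (ζ : ℂ) :
    HG m n ζ = FF m n ζ := by
  rw [FF_eq_sum hm hn]
  unfold HG QG
  refine Finset.sum_congr rfl fun k hk => ?_
  rw [BG, if_neg, add_zero]
  rintro ⟨h1, h2⟩
  rcases h with h | h
  · exact Nat.not_even_iff_odd.mpr h h1
  · have := h.of_dvd_nat (Nat.dvd_of_mem_divisors hk)
    rw [Nat.odd_iff] at this
    omega

theorem HG_of_even {m v q : ℕ} (hm : 1 ≤ m) (hme : Even m) (hq : Odd q) (hv : 1 ≤ v) (ζ : ℂ) :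
    HG m (2 ^ v * q) ζ = FF m (2 ^ v * q) ζ + 2 * FF m q (ζ ^ (2 ^ v)) := by
  have hq0 : 1 ≤ q := hq.pos
  have hn : 1 ≤ 2 ^ v * q := Nat.mul_pos (by positivity) hq0
  rw [FF_eq_sum hm hn, FF_eq_sum hm hq0]
  unfold HG QG
  rw [Finset.sum_add_distrib]
  congr 1
  unfold BG
  rw [← Finset.sum_filter_of_ne (p := fun k => k % 4 = 2)]
  swap
  · intro k _ h
    by_contra h'
    exact h (if_neg (fun h2 => h' h2.2))
  rw [Finset.mul_sum]
  obtain ⟨u, rfl⟩ : ∃ u, v = u + 1 := ⟨v - 1, by omega⟩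
  refine Finset.sum_bij' (fun k _ => k / 2) (fun j _ => 2 * j) ?_ ?_ ?_ ?_ ?_
  · intro k hk
    simp only [Finset.mem_filter, Nat.mem_divisors] at hk ⊢
    refine ⟨?_, by omega⟩
    have h1 : k / 2 ∣ 2 ^ (u + 1) * q := (Nat.div_dvd_of_dvd (by omega)).trans hk.1.1
    refine Nat.Coprime.dvd_of_dvd_mul_left ?_ h1
    apply Nat.Coprime.pow_right
    rw [Nat.coprime_two_right, Nat.odd_iff]; omega
  · intro j hj
    simp only [Finset.mem_filter, Nat.mem_divisors] at hj ⊢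
    have := hq.of_dvd_nat hj.1
    rw [Nat.odd_iff] at this
    refine ⟨⟨?_, by omega⟩, by omega⟩
    rw [pow_succ, mul_assoc]
    exact Dvd.dvd.mul_left (Nat.mul_dvd_mul_left 2 hj.1) _
  · intro k hk
    simp only [Finset.mem_filter] at hk
    omega
  · intro j hj
    omega
  · intro k hk
    simp only [Finset.mem_filter, Nat.mem_divisors] at hk
    rw [if_pos ⟨hme, hk.2⟩, ← pow_mul, ← pow_mul]
    obtain ⟨j, rfl⟩ : 2 ∣ k := by omega
    have hj : 0 < j := by omega
    have h1 : j ∣ q := by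
      have h1 : j ∣ 2 ^ (u + 1) * q := (Dvd.intro_left 2 rfl).trans hk.1.1
      refine Nat.Coprime.dvd_of_dvd_mul_left ?_ h1
      apply Nat.Coprime.pow_right
      rw [Nat.coprime_two_right, Nat.odd_iff]; omega
    obtain ⟨r, rfl⟩ := h1
    have e1 : 2 ^ (u + 1) * (j * r) = (2 * j) * (2 ^ u * r) := by ring
    rw [e1, Nat.mul_div_cancel_left _ (by omega), Nat.mul_div_cancel_left _ (by omega),
      Nat.mul_div_cancel_left _ hj]
    congr 3
    ring

theorem HG_one_eq {m n d e : ℕ} (hm : 1 ≤ m) (hd : 0 < d) (he : 0 < e) (hn : n = d * e) {ζ : ℂ}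
    (hζ : IsPrimitiveRoot ζ d) : HG m n ζ = HG m e 1 := by
  have hn1 : 1 ≤ n := hn ▸ Nat.mul_pos hd he
  have hζn : ζ ^ n = 1 := by rw [hn, pow_mul, hζ.pow_eq_one, one_pow]
  have key := FF_eval hm hd he hζ
  rw [← hn] at key
  have keyodd : ∀ d e : ℕ, 0 < d → 0 < e → (Odd m ∨ Odd (d * e)) → ∀ ζ : ℂ, IsPrimitiveRoot ζ d →
      FF m (d * e) ζ = FF m e 1 := by
    intro d e hd he h ζ hζ
    rw [FF_eval hm hd he hζ, FF_one]
    have : ζ ^ ((m - 1) * (d * e * (d * e - 1) / 2)) = 1 := by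
      rw [hζ.pow_eq_one_iff_dvd]
      rcases h with h | h
      · obtain ⟨r, hr⟩ := h
        have h2 : 2 ∣ d * e * (d * e - 1) := (Nat.even_mul_pred_self _).two_dvd
        obtain ⟨t, ht⟩ := h2
        rw [ht, Nat.mul_div_cancel_left _ (by norm_num), hr, Nat.add_sub_cancel,
          show 2 * r * t = r * (2 * t) by ring, ← ht]
        exact ⟨r * (e * (d * e - 1)), by ring⟩
      · obtain ⟨r, hr⟩ := h
        have : d * e - 1 = 2 * r := by omega
        rw [this, show d * e * (2 * r) = 2 * (d * e * r) by ring,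
          Nat.mul_div_cancel_left _ (by norm_num)]
        exact ⟨(m - 1) * (e * r), by ring⟩
    rw [this, one_mul]
  by_cases hodd : Odd m ∨ Odd n
  · have hodd' : Odd m ∨ Odd e := hodd.imp id fun h => h.of_dvd_nat (hn ▸ Dvd.intro_left d rfl)
    rw [HG_of_odd hm hn1 hodd, HG_of_odd hm he hodd', hn]
    exact keyodd d e hd he (hn ▸ hodd) ζ hζ
  · push Not at hodd
    obtain ⟨hme, hne⟩ := hodd
    obtain ⟨u, d', hd', rfl⟩ := Nat.exists_eq_two_pow_mul_odd hd.ne'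
    obtain ⟨w, e', he', rfl⟩ := Nat.exists_eq_two_pow_mul_odd he.ne'
    have hn2 : n = 2 ^ (u + w) * (d' * e') := by rw [hn]; ring
    have hv : 1 ≤ u + w := by
      by_contra h
      have : u + w = 0 := by omega
      rw [this] at hn2
      exact (Nat.not_even_iff_odd.mpr (hd'.mul he')) (by simpa [hn2] using hne)
    rw [Nat.not_odd_iff_even] at hme hne
    have hprim : IsPrimitiveRoot (ζ ^ 2 ^ (u + w)) d' := by
      rw [pow_add, pow_mul]
      refine (hζ.pow hd rfl).pow_of_coprime _ ?_
      exact Nat.Coprime.pow_left _ ((Nat.coprime_two_left).mpr hd')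
    have hodd2 := keyodd d' e' hd'.pos he'.pos (Or.inr (hd'.mul he')) _ hprim
    have hH : HG m n ζ = FF m n ζ + 2 * FF m e' 1 := by
      rw [hn2, HG_of_even hm hme (hd'.mul he') hv, hodd2]
    rw [hH, key]
    have hsg : ζ ^ ((m - 1) * (n * (n - 1) / 2))
        = (ζ ^ (n / 2)) ^ ((m - 1) * (n - 1)) := by
      rw [← pow_mul]
      congr 1
      obtain ⟨r, hr⟩ := hne.two_dvd
      rw [hr, mul_assoc, Nat.mul_div_cancel_left _ (by norm_num), Nat.mul_div_cancel_left _ (by norm_num)]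
      ring
    rw [hsg]
    rcases Nat.eq_zero_or_pos w with rfl | hw
    · have : ζ ^ (n / 2) = -1 := by
        have h1 : (ζ ^ (n / 2)) ^ 2 = 1 := by
          rw [← pow_mul, Nat.div_mul_cancel hne.two_dvd, hζn]
        rcases (sq_eq_sq_iff_eq_or_eq_neg.mp (h1.trans (one_pow 2).symm)) with h | h
        · exfalso
          rw [hζ.pow_eq_one_iff_dvd] at h
          obtain ⟨c, hc⟩ := h
          have h3 : n = 2 * (2 ^ u * d' * c) := by
            rw [← hc]; exact (Nat.mul_div_cancel' hne.two_dvd).symm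
          have h4 : 2 ^ u * d' * e' = 2 ^ u * d' * (2 * c) := by
            rw [show 2 ^ u * d' * (2 * c) = 2 * (2 ^ u * d' * c) by ring, ← h3, hn]; ring
          have h5 := Nat.eq_of_mul_eq_mul_left hd h4
          exact Nat.not_even_iff_odd.mpr he' (h5 ▸ even_two_mul c)
        · exact h
      have hod : Odd ((m - 1) * (n - 1)) := by
        apply Odd.mul
        · exact Nat.Even.sub_odd hm hme odd_one
        · exact Nat.Even.sub_odd hn1 hne odd_one
      rw [this, hod.neg_one_pow, HG_of_odd hm he (Or.inr (by simpa using he')), FF_one]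
      simp only [pow_zero, one_mul, FF_one]
      ring
    · have : ζ ^ (n / 2) = 1 := by
        rw [hζ.pow_eq_one_iff_dvd]
        obtain ⟨w, rfl⟩ : ∃ k, w = k + 1 := ⟨w - 1, by omega⟩
        rw [hn, show 2 ^ u * d' * (2 ^ (w + 1) * e') = 2 * (2 ^ u * d' * (2 ^ w * e')) by ring,
          Nat.mul_div_cancel_left _ (by norm_num)]
        exact Dvd.intro _ rfl
      rw [this, one_pow, one_mul, HG_of_even hm hme he' hw, one_pow, FF_one, FF_one]

theorem QG_zero {m : ℕ} (hm : 1 ≤ m) : ∀ n : ℕ, 1 ≤ n → ∀ ζ : ℂ, ζ ^ n = 1 → ζ ≠ 1 → QG m n ζ = 0 := by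
  intro n
  induction n using Nat.strong_induction_on with
  | _ n ih =>
  intro hn ζ hζ h1
  set d := orderOf ζ with hd
  have hprim : IsPrimitiveRoot ζ d := IsPrimitiveRoot.orderOf ζ
  obtain ⟨e, he⟩ : d ∣ n := orderOf_dvd_of_pow_eq_one hζ
  have hd0 : 0 < d := Nat.pos_of_ne_zero (by rintro h; simp [h] at he; omega)
  have he0 : 0 < e := Nat.pos_of_ne_zero (by rintro rfl; simp at he; omega)
  have hd1 : d ≠ 1 := fun h => h1 (orderOf_eq_one_iff.mp h)
  have hH := HG_one_eq hm hd0 he0 he hprim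
  unfold HG at hH
  rw [← Finset.sum_erase_add _ _ (Nat.mem_divisors_self n (by omega)), Nat.div_self hn, pow_one]
    at hH
  have : ∑ k ∈ n.divisors.erase n, QG m k (ζ ^ (n / k)) = ∑ k ∈ e.divisors, QG m k (1 ^ (e / k)) := by
    symm
    refine Finset.sum_subset_zero_on_sdiff ?_ ?_ ?_
    · intro k hk
      have hk' := Nat.dvd_of_mem_divisors hk
      simp only [Finset.mem_erase, Nat.mem_divisors]
      refine ⟨?_, hk'.trans ⟨d, by rw [he]; ring⟩, by omega⟩
      have := Nat.le_of_dvd he0 hk'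
      have : 2 * e ≤ d * e := Nat.mul_le_mul_right e (by omega)
      omega
    · intro k hk
      simp only [Finset.mem_sdiff, Finset.mem_erase, Nat.mem_divisors] at hk
      obtain ⟨⟨hkn, hk1, _⟩, hk2⟩ := hk
      obtain ⟨c, hc⟩ := hk1
      have hk0 : 0 < k := Nat.pos_of_ne_zero (by rintro rfl; simp at hc; omega)
      refine ih k (lt_of_le_of_ne (Nat.le_of_dvd hn ⟨c, hc⟩) hkn) hk0 _ ?_ ?_
      · rw [← pow_mul, Nat.div_mul_cancel ⟨c, hc⟩, hζ]
      · rw [Ne, hprim.pow_eq_one_iff_dvd, hc, Nat.mul_div_cancel_left _ hk0]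
        rintro ⟨t, rfl⟩
        refine hk2 ⟨⟨t, ?_⟩, he0.ne'⟩
        apply Nat.eq_of_mul_eq_mul_left hd0
        rw [← he, hc]; ring
    · intro k hk
      obtain ⟨c, rfl⟩ := Nat.dvd_of_mem_divisors hk
      have hk0 : 0 < k := Nat.pos_of_mul_pos_right he0
      rw [one_pow, he, show d * (k * c) = k * (d * c) by ring, Nat.mul_div_cancel_left _ hk0, pow_mul,
        hprim.pow_eq_one, one_pow]
  rw [this] at hH
  simpa using hH

/-- The plus set. -/
noncomputable def TF (m n : ℕ) : Finset (ℕ → ℕ) :=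
  open Classical in
  PF m n ∪ (if Even m ∧ n % 4 = 2 then PF m (n / 2) else ∅)

theorem PF_per {m n : ℕ} {f : ℕ → ℕ} (hf : f ∈ PF m n) : per f = n := (Finset.mem_filter.mp hf).2

theorem TF_sum {m n : ℕ} (hm : 1 ≤ m) (hn : 1 ≤ n) (ζ : ℂ) :
    n * ∑ f ∈ TF m n, ζ ^ (wF m n f) * (per f : ℂ)⁻¹ = QG m n ζ := by
  classical
  have hP : ∀ k ≥ 1, ∀ φ : (ℕ → ℕ) → ℂ, ∑ f ∈ PF m k, φ f * (per f : ℂ)⁻¹ = (k : ℂ)⁻¹ * ∑ f ∈ PF m k, φ f := by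
    intro k _ φ
    rw [Finset.mul_sum]
    refine Finset.sum_congr rfl fun f hf => ?_
    rw [PF_per hf, mul_comm]
  have hn0 : (n : ℂ) ≠ 0 := by exact_mod_cast (by omega : n ≠ 0)
  unfold TF QG BG
  split_ifs with h
  · obtain ⟨r, hr⟩ : 2 ∣ n := by omega
    have hr' : n / 2 = r := by omega
    have hr0 : 1 ≤ r := by omega
    have hr1 : (r : ℂ) ≠ 0 := by exact_mod_cast (by omega : r ≠ 0)
    rw [Finset.sum_union, hP n hn, hr', hP r hr0, mul_add, ← mul_assoc, mul_inv_cancel₀ hn0, one_mul]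
    · congr 1
      rw [← PG_pow hm hr0, mul_comm r 2, ← hr, ← mul_assoc]
      congr 1
      rw [hr]; push_cast; field_simp
    · rw [Finset.disjoint_left]
      intro f h1 h2
      have := PF_per h1
      have := PF_per h2
      omega
  · rw [Finset.union_empty, hP n hn, ← mul_assoc, mul_inv_cancel₀ hn0, one_mul, add_zero]
    rfl

theorem TF_equi {m n : ℕ} (hm : 1 ≤ m) (hn : 1 ≤ n) (i : ℤ) :
    n * ∑ f ∈ (TF m n).filter (fun f => wF m n f ≡ i [ZMOD n]), (per f : ℂ)⁻¹
      = ∑ f ∈ TF m n, (per f : ℂ)⁻¹ := by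
  have hn0 : (n : ℂ) ≠ 0 := by exact_mod_cast (by omega : n ≠ 0)
  obtain ⟨ω, hω⟩ : ∃ ω : ℂ, IsPrimitiveRoot ω n := ⟨_, Complex.isPrimitiveRoot_exp n (by omega)⟩
  have hω0 : ω ≠ 0 := hω.ne_zero (by omega)
  have hD : ∀ ζ : ℂ, ζ ^ n = 1 → ζ ≠ 1 → ∑ f ∈ TF m n, ζ ^ (wF m n f) * (per f : ℂ)⁻¹ = 0 := by
    intro ζ h1 h2
    have := TF_sum hm hn ζ
    rw [QG_zero hm n hn ζ h1 h2] at this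
    exact (mul_eq_zero.mp this).resolve_left hn0
  have horth : ∀ w : ℤ, ∑ t ∈ Finset.range n, (ω ^ t) ^ (w - i) = if w ≡ i [ZMOD n] then (n : ℂ) else 0 := by
    intro w
    have hc : ∀ t : ℕ, (ω ^ t) ^ (w - i) = (ω ^ (w - i)) ^ t := by
      intro t
      rw [← zpow_natCast, ← zpow_natCast, ← zpow_mul, ← zpow_mul, mul_comm]
    simp_rw [hc]
    split_ifs with h
    · have : ω ^ (w - i) = 1 := by
        rw [hω.zpow_eq_one_iff_dvd]
        exact h.symm.dvd
      simp [this]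
    · have : ω ^ (w - i) ≠ 1 := by
        rw [Ne, hω.zpow_eq_one_iff_dvd]
        exact fun h' => h (Int.modEq_iff_dvd.mpr h').symm
      rw [geom_sum_eq this, ← hc, hω.pow_eq_one, one_zpow, sub_self, zero_div]
  calc _ = ∑ f ∈ TF m n, (∑ t ∈ Finset.range n, (ω ^ t) ^ (wF m n f - i)) * (per f : ℂ)⁻¹ := by
        rw [Finset.sum_filter, Finset.mul_sum]
        refine Finset.sum_congr rfl fun f _ => ?_
        rw [horth]
        split_ifs <;> simp
    _ = ∑ t ∈ Finset.range n, (ω ^ t) ^ (-i) * ∑ f ∈ TF m n, (ω ^ t) ^ (wF m n f) * (per f : ℂ)⁻¹ := by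
        simp_rw [Finset.sum_mul]
        rw [Finset.sum_comm]
        refine Finset.sum_congr rfl fun t _ => ?_
        rw [Finset.mul_sum]
        refine Finset.sum_congr rfl fun f _ => ?_
        rw [← mul_assoc, ← zpow_add₀ (pow_ne_zero t hω0)]
        congr 2
        ring
    _ = _ := by
        rw [Finset.sum_eq_single_of_mem 0 (Finset.mem_range.mpr hn)]
        · simp
        · intro t ht ht0
          rw [hD (ω ^ t), mul_zero]
          · rw [← pow_mul, mul_comm, pow_mul, hω.pow_eq_one, one_pow]
          · exact hω.pow_ne_one_of_pos_of_lt ht0 (Finset.mem_range.mp ht)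

/-- The list of the first `n` values. -/
def toL (n : ℕ) (f : ℕ → ℕ) : List ℕ := (List.range n).map f

theorem toL_length (n : ℕ) (f : ℕ → ℕ) : (toL n f).length = n := by simp [toL]

theorem toL_getD {n : ℕ} (f : ℕ → ℕ) {i : ℕ} (hi : i < n) : (toL n f).getD i 0 = f i := by
  simp [toL, List.getD_eq_getElem?_getD, hi]

theorem toL_wt (m n : ℕ) (f : ℕ → ℕ) : wtZ m (toL n f) = wF m n f := by
  unfold wtZ wF
  rw [toL_length]
  exact Finset.sum_congr rfl fun i hi => by rw [toL_getD f (Finset.mem_range.mp hi)]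

theorem toL_sum (n : ℕ) (f : ℕ → ℕ) : (toL n f).sum = ∑ i ∈ Finset.range n, f i := by
  rw [toL]
  induction n with
  | zero => simp
  | succ n ih => rw [List.range_succ, Finset.sum_range_succ, ← ih]; simp

theorem per_mod {n : ℕ} {f : ℕ → ℕ} (hf : Function.IsPeriodicPt sh n f) (i : ℕ) :
    f (i % n) = f i :=
  Function.Periodic.map_mod_nat (f := f) ((isPer_iff _ _).mp hf) i

theorem toL_rotate {n : ℕ} {f : ℕ → ℕ} (hf : Function.IsPeriodicPt sh n f) (k : ℕ) :
    (toL n f).rotate k = toL n (sh^[k] f) := by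
  apply List.ext_getElem
  · simp [toL]
  · intro i h1 h2
    rw [List.getElem_rotate]
    simp only [toL, List.length_map, List.length_range, List.getElem_map, List.getElem_range]
    rw [sh_iter, per_mod hf]

theorem toL_inj {n : ℕ} (hn : 1 ≤ n) {f g : ℕ → ℕ} (hf : Function.IsPeriodicPt sh n f)
    (hg : Function.IsPeriodicPt sh n g) (h : toL n f = toL n g) : f = g := by
  funext i
  rw [← per_mod hf, ← per_mod hg, ← toL_getD f (Nat.mod_lt i hn), ← toL_getD g (Nat.mod_lt i hn), h]

theorem iter_per {n : ℕ} {f : ℕ → ℕ} (hf : Function.IsPeriodicPt sh n f) (k : ℕ) :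
    Function.IsPeriodicPt sh n (sh^[k] f) := hf.apply_iterate k

theorem toL_surj {n : ℕ} {a : List ℕ} (ha : a.length = n) :
    ∃ f, Function.IsPeriodicPt sh n f ∧ toL n f = a := by
  refine ⟨fun i => a.getD (i % n) 0, ?_, ?_⟩
  · rw [isPer_iff]; intro i; simp
  · apply List.ext_getElem
    · simp [toL, ha]
    · intro i h1 h2
      have : i % n = i := Nat.mod_eq_of_lt (by omega)
      simp [toL, this, h2]

theorem toL_prim {n : ℕ} (hn : 1 ≤ n) {f : ℕ → ℕ} (hf : Function.IsPeriodicPt sh n f) :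
    Primitive (toL n f) ↔ per f = n := by
  have hiff : ∀ i, (toL n f).rotate i = toL n f ↔ per f ∣ i := by
    intro i
    rw [toL_rotate hf, per, ← Function.isPeriodicPt_iff_minimalPeriod_dvd]
    exact ⟨fun h => toL_inj hn (iter_per hf i) hf h, fun h => by rw [show sh^[i] f = f from h]⟩
  have hdvd : per f ∣ n := hf.minimalPeriod_dvd
  have hpos : 0 < per f := Nat.pos_of_dvd_of_pos hdvd hn
  unfold Primitive
  simp only [toL_length, Ne, hiff]
  constructor
  · intro h
    by_contra hne
    exact h (per f) hpos (lt_of_le_of_ne (Nat.le_of_dvd hn hdvd) hne) dvd_rfl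
  · intro h i h1 h2 h3
    rw [h] at h3
    exact absurd (Nat.le_of_dvd h1 h3) (by omega)

theorem UPrim_iff {m n : ℕ} (hn : 1 ≤ n) (a : List ℕ) :
    a ∈ UPrim m n ↔ ∃ f ∈ PF m n, toL n f = a := by
  constructor
  · rintro ⟨⟨h1, h2⟩, h3⟩
    obtain ⟨f, hf, rfl⟩ := toL_surj h1
    refine ⟨f, Finset.mem_filter.mpr ⟨(mem_UF hn f).mpr ⟨hf, ?_⟩, (toL_prim hn hf).mp h3⟩, rfl⟩
    rw [← toL_sum, h2]
  · rintro ⟨f, hf, rfl⟩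
    obtain ⟨h1, h2⟩ := Finset.mem_filter.mp hf
    obtain ⟨h3, h4⟩ := (mem_UF hn f).mp h1
    exact ⟨⟨toL_length n f, by rw [toL_sum, h4]⟩, (toL_prim hn h3).mpr h2⟩

theorem toL_double {r : ℕ} {f : ℕ → ℕ} (hf : Function.IsPeriodicPt sh r f) :
    toL (r * 2) f = toL r f ++ toL r f := by
  rw [toL, mul_two, List.range_add, List.map_append, List.map_map]
  congr 1
  apply List.map_congr_left
  intro i _
  simp only [Function.comp]
  rw [add_comm]
  exact (isPer_iff _ _).mp hf i

theorem PF_isPer {m n : ℕ} {f : ℕ → ℕ} (hf : f ∈ PF m n) : Function.IsPeriodicPt sh n f := by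
  rw [Function.isPeriodicPt_iff_minimalPeriod_dvd]
  exact dvd_of_eq (PF_per hf)

theorem mem_TF {m n : ℕ} (f : ℕ → ℕ) :
    f ∈ TF m n ↔ f ∈ PF m n ∨ (Even m ∧ n % 4 = 2 ∧ f ∈ PF m (n / 2)) := by
  unfold TF
  split_ifs with h
  · simp [h.1, h.2]
  · simp only [Finset.union_empty]
    tauto

theorem UPrimPlus_iff {m n : ℕ} (hn : 1 ≤ n) (a : List ℕ) :
    a ∈ UPrimPlus m n ↔ ∃ f ∈ TF m n, toL n f = a := by
  unfold UPrimPlus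
  simp only [Set.mem_union, Set.mem_setOf_eq, UPrim_iff hn, mem_TF]
  constructor
  · rintro (⟨f, hf, rfl⟩ | ⟨h1, h2, b, hb, rfl⟩)
    · exact ⟨f, Or.inl hf, rfl⟩
    · obtain ⟨f, hf, rfl⟩ := (UPrim_iff (by omega) b).mp hb
      refine ⟨f, Or.inr ⟨h1, h2, hf⟩, ?_⟩
      rw [← toL_double (PF_isPer hf), show n / 2 * 2 = n by omega]
  · rintro ⟨f, hf | ⟨h1, h2, hf⟩, rfl⟩
    · exact Or.inl ⟨f, hf, rfl⟩
    · refine Or.inr ⟨h1, h2, toL (n / 2) f, (UPrim_iff (by omega) _).mpr ⟨f, hf, rfl⟩, ?_⟩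
      rw [← toL_double (PF_isPer hf), show n / 2 * 2 = n by omega]

theorem TF_sub {m n : ℕ} (hn : 1 ≤ n) {f : ℕ → ℕ} (hf : f ∈ TF m n) : f ∈ UF m n := by
  rcases (mem_TF f).mp hf with h | ⟨_, h2, h⟩
  · exact (Finset.mem_filter.mp h).1
  · have := (UF_mul (e := 2) (by omega) (by norm_num) f (PF_isPer h)).mpr (Finset.mem_filter.mp h).1
    rwa [show n / 2 * 2 = n by omega] at this

theorem PF_sh {m n : ℕ} (hn : 1 ≤ n) {f : ℕ → ℕ} (hf : f ∈ PF m n) : sh f ∈ PF m n := by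
  refine Finset.mem_filter.mpr ⟨sh_UF hn (Finset.mem_filter.mp hf).1, ?_⟩
  rw [← PF_per hf, per, Function.minimalPeriod_apply ⟨n, hn, PF_isPer hf⟩, ← per, PF_per hf]

theorem TF_sh {m n : ℕ} (hn : 1 ≤ n) {f : ℕ → ℕ} (hf : f ∈ TF m n) : sh f ∈ TF m n := by
  rw [mem_TF] at hf ⊢
  rcases hf with h | ⟨h1, h2, h⟩
  · exact Or.inl (PF_sh hn h)
  · exact Or.inr ⟨h1, h2, PF_sh (by omega) h⟩

theorem iter_mem {S : Finset (ℕ → ℕ)} (hS : ∀ f ∈ S, sh f ∈ S) {f : ℕ → ℕ} (hf : f ∈ S) (k : ℕ) :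
    sh^[k] f ∈ S := by
  induction k with
  | zero => exact hf
  | succ k ih => rw [Function.iterate_succ_apply']; exact hS _ ih

theorem wF_iter {m n : ℕ} (hm : 1 ≤ m) (hn : 1 ≤ n) {f : ℕ → ℕ} (hf : f ∈ UF m n) (k : ℕ) :
    wF m n (sh^[k] f) ≡ wF m n f [ZMOD n] := by
  induction k with
  | zero => rfl
  | succ k ih =>
    rw [Function.iterate_succ_apply', wF_sh hm hn (iter_mem (fun f => sh_UF hn) hf k)]
    refine Int.ModEq.trans ?_ ih
    rw [Int.modEq_iff_dvd]
    exact ⟨_, by rw [sub_sub_cancel]⟩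

theorem rotClass_toL {n : ℕ} {f : ℕ → ℕ} (hf : Function.IsPeriodicPt sh n f) :
    rotClass (toL n f) = {b | ∃ k, b = toL n (sh^[k] f)} := by
  unfold rotClass
  simp only [toL_rotate hf]

theorem wtOrb_eq {m n : ℕ} (hm : 1 ≤ m) (hn : 1 ≤ n) {f : ℕ → ℕ} (hf : f ∈ UF m n) :
    wtOrb m (rotClass (toL n f)) ≡ wF m n f [ZMOD n] := by
  have hp := ((mem_UF hn f).mp hf).1
  have hset : wtZ m '' (rotClass (toL n f)) ⊆ (UF m n).image (wF m n) := by
    rw [rotClass_toL hp]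
    rintro _ ⟨_, ⟨k, rfl⟩, rfl⟩
    rw [toL_wt]
    exact Finset.mem_coe.mpr (Finset.mem_image_of_mem _ (iter_mem (fun f => sh_UF hn) hf k))
  have hfin : (wtZ m '' (rotClass (toL n f))).Finite := (Finset.finite_toSet _).subset hset
  have hne : (wtZ m '' (rotClass (toL n f))).Nonempty := ⟨_, toL n f, ⟨0, by simp⟩, rfl⟩
  have := hne.csSup_mem hfin
  rw [← wtOrb, rotClass_toL hp] at this
  obtain ⟨_, ⟨k, rfl⟩, h⟩ := this
  rw [rotClass_toL hp, ← h, toL_wt]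
  exact wF_iter hm hn hf k

open Classical in
theorem orbit_count {m n : ℕ} (hn : 1 ≤ n) (S : Finset (ℕ → ℕ)) (hSU : ∀ f ∈ S, f ∈ UF m n)
    (hS : ∀ f ∈ S, sh f ∈ S) :
    ((S.image (fun f => rotClass (toL n f))).card : ℂ) = ∑ f ∈ S, (per f : ℂ)⁻¹ := by
  have hp : ∀ f ∈ S, Function.IsPeriodicPt sh n f := fun f hf => ((mem_UF hn f).mp (hSU f hf)).1
  rw [← Finset.sum_fiberwise_of_maps_to (g := fun f => rotClass (toL n f))
    (t := S.image (fun f => rotClass (toL n f))) (fun f hf => Finset.mem_image_of_mem _ hf),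
    Finset.card_eq_sum_ones, Nat.cast_sum]
  refine Finset.sum_congr rfl fun O hO => ?_
  obtain ⟨f, hf, rfl⟩ := Finset.mem_image.mp hO
  have hpos : 0 < per f := (hp f hf).minimalPeriod_pos hn
  have hfib : S.filter (fun g => rotClass (toL n g) = rotClass (toL n f))
      = (Finset.range (per f)).image (fun k => sh^[k] f) := by
    ext g
    simp only [Finset.mem_filter, Finset.mem_image, Finset.mem_range]
    constructor
    · rintro ⟨hg, h⟩
      have h1 : toL n g ∈ rotClass (toL n f) := by rw [← h]; exact ⟨0, by simp⟩
      rw [rotClass_toL (hp f hf)] at h1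
      obtain ⟨k, hk⟩ := h1
      have := toL_inj hn (hp g hg) (iter_per (hp f hf) k) hk
      refine ⟨k % per f, Nat.mod_lt _ hpos, ?_⟩
      rw [this]
      exact Function.iterate_mod_minimalPeriod_eq
    · rintro ⟨k, _, rfl⟩
      refine ⟨iter_mem hS hf k, ?_⟩
      rw [← toL_rotate (hp f hf)]
      unfold rotClass
      ext b
      simp only [Set.mem_setOf_eq]
      constructor
      · rintro ⟨i, rfl⟩
        exact ⟨k + i, by rw [List.rotate_rotate]⟩
      · rintro ⟨i, rfl⟩
        have hl : (toL n f).rotate (n * k) = toL n f := by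
          have := List.rotate_length_mul (toL n f) k
          rwa [toL_length] at this
        refine ⟨n * k - k + i, ?_⟩
        rw [List.rotate_rotate]
        have : k ≤ n * k := Nat.le_mul_of_pos_left k hn
        rw [show k + (n * k - k + i) = n * k + i by omega, ← List.rotate_rotate, hl]
  rw [hfib, Finset.sum_image]
  · have : ∀ k ∈ Finset.range (per f), ((per (sh^[k] f) : ℂ))⁻¹ = (per f : ℂ)⁻¹ := by
      intro k _
      rw [per, Function.minimalPeriod_apply_iterate ⟨n, hn, hp f hf⟩, ← per]
    rw [Finset.sum_congr rfl this]
    have : (per f : ℂ) ≠ 0 := by exact_mod_cast hpos.ne'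
    simp [this]
  · intro a ha b hb hab
    simp only [Finset.coe_range] at ha hb
    exact Function.iterate_injOn_Iio_minimalPeriod ha hb hab

open Classical in
theorem orbitsOn_eq {m n : ℕ} (hn : 1 ≤ n) :
    orbitsOn (UPrimPlus m n) = ((TF m n).image (fun f => rotClass (toL n f)) : Finset _) := by
  ext O
  simp only [orbitsOn, Set.mem_setOf_eq, UPrimPlus_iff hn, Finset.coe_image, Set.mem_image,
    Finset.mem_coe]
  constructor
  · rintro ⟨_, ⟨f, hf, rfl⟩, rfl⟩
    exact ⟨f, hf, rfl⟩
  · rintro ⟨f, hf, rfl⟩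
    exact ⟨_, ⟨f, hf, rfl⟩, rfl⟩

open Classical in
theorem orbitsOn_filter_eq {m n : ℕ} (hm : 1 ≤ m) (hn : 1 ≤ n) (i : ℤ) :
    {O ∈ orbitsOn (UPrimPlus m n) | wtOrb m O ≡ i [ZMOD (n : ℤ)]} =
      (((TF m n).filter (fun f => wF m n f ≡ i [ZMOD n])).image
        (fun f => rotClass (toL n f)) : Finset _) := by
  ext O
  rw [orbitsOn_eq hn]
  simp only [Set.mem_setOf_eq, Finset.coe_image, Set.mem_image, Finset.mem_coe, Finset.mem_filter]
  constructor
  · rintro ⟨⟨f, hf, rfl⟩, h⟩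
    exact ⟨f, ⟨hf, (wtOrb_eq hm hn (TF_sub hn hf)).symm.trans h⟩, rfl⟩
  · rintro ⟨f, ⟨hf, h⟩, rfl⟩
    exact ⟨⟨f, hf, rfl⟩, (wtOrb_eq hm hn (TF_sub hn hf)).trans h⟩

theorem main_count {m n : ℕ} (hm : 1 ≤ m) (hn : 1 ≤ n) (i : ℤ) :
    n * Set.ncard {O ∈ orbitsOn (UPrimPlus m n) | wtOrb m O ≡ i [ZMOD (n : ℤ)]}
          = Set.ncard (orbitsOn (UPrimPlus m n)) := by
  classical
  rw [orbitsOn_filter_eq hm hn, orbitsOn_eq hn, Set.ncard_coe_finset, Set.ncard_coe_finset]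
  have h1 := orbit_count hn (TF m n) (fun f => TF_sub hn) (fun f => TF_sh hn)
  have h2 := orbit_count hn ((TF m n).filter (fun f => wF m n f ≡ i [ZMOD n]))
    (fun f hf => TF_sub hn (Finset.mem_filter.mp hf).1)
    (fun f hf => by
      obtain ⟨h1, h2⟩ := Finset.mem_filter.mp hf
      exact Finset.mem_filter.mpr ⟨TF_sh hn h1, (wF_iter hm hn (TF_sub hn h1) 1).trans h2⟩)
  have h3 := TF_equi hm hn i
  rw [← h1, ← h2] at h3
  exact_mod_cast h3

/-- The number of `C_n`-orbits on `U_n^{prim,+}` with `wt(C) ≡ i (mod n)` is independent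
of `i`; equivalently, `n` times this number is the total number of orbits. -/
theorem stmt15 (m n : ℕ) (hm : 1 ≤ m) (hn : 1 ≤ n) :
    (∀ i j : ℤ,
      Set.ncard {O ∈ orbitsOn (UPrimPlus m n) | wtOrb m O ≡ i [ZMOD (n : ℤ)]}
        = Set.ncard {O ∈ orbitsOn (UPrimPlus m n) | wtOrb m O ≡ j [ZMOD (n : ℤ)]})
    ∧ ∀ i : ℤ,
        n * Set.ncard {O ∈ orbitsOn (UPrimPlus m n) | wtOrb m O ≡ i [ZMOD (n : ℤ)]}
          = Set.ncard (orbitsOn (UPrimPlus m n)) := by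
  refine ⟨fun i j => ?_, fun i => main_count hm hn i⟩
  exact Nat.eq_of_mul_eq_mul_left hn ((main_count hm hn i).trans (main_count hm hn j).symm)
end
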